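/- Let w₁, w₂ > 0 with w₁ + w₂ = 1 and a > 0. Define P_T = w₁ · T^{⌊aT⌋} e^{−T} / (⌊aT⌋)! + w₂ · (2T)^{⌊aT⌋} e^{−2T} / (⌊aT⌋)!. Then lim_{T → ∞} −(1/T) · ln P_T = a·ln a − a + 1 if 0 < a < 1/ln 2, and = a·ln(a/2) − a + 2 if a ≥ 1/ln 2. In particular this limit, as a function of a, is non-convex. -/

import Mathlib

open Filter Real

/-- Leading-order Stirling formula: `log n! = n log n - n + o(n)`. -/
lemma tendsto_log_factorial_sub_div :
    Tendsto (fun n : ℕ => (Real.log n.factorial - n * Real.log n + n) / n) atTop (nhds 0) := by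
  have hstirling : Tendsto (fun n : ℕ => Real.log (Stirling.stirlingSeq n)) atTop
      (nhds (Real.log √π)) :=
    Stirling.tendsto_stirlingSeq_sqrt_pi.log (by positivity)
  have hlog : Tendsto (fun n : ℕ => Real.log n / (n : ℝ)) atTop (nhds 0) :=
    Real.isLittleO_log_id_atTop.tendsto_div_nhds_zero.comp tendsto_natCast_atTop_atTop
  have hlim := ((hstirling.add_const (1 / 2 * Real.log 2)).div_atTop
    (tendsto_natCast_atTop_atTop (R := ℝ))).add (hlog.const_mul (1 / 2))
  rw [mul_zero, add_zero] at hlim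
  refine hlim.congr' ?_
  filter_upwards [eventually_ge_atTop 1] with n hn
  have hn0 : (n : ℝ) ≠ 0 := by positivity
  rw [Stirling.log_stirlingSeq_formula, Real.log_mul two_ne_zero hn0,
    Real.log_div hn0 (exp_ne_zero 1), Real.log_exp]
  field_simp
  ring

/-- Exponential decay rate of a weighted Poisson probability of intensity `r`. -/
lemma tendsto_neg_log_poisson_weight {w r a : ℝ} (hw : 0 < w) (hr : 0 < r) (ha : 0 < a) :
    Tendsto (fun T : ℝ => -(1 / T) * Real.log
        (w * (r * T) ^ ⌊a * T⌋₊ * exp (-(r * T)) / (Nat.factorial ⌊a * T⌋₊)))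
      atTop (nhds (a * Real.log (a / r) - a + r)) := by
  have hfloor : Tendsto (fun T : ℝ => ⌊a * T⌋₊) atTop atTop :=
    tendsto_nat_floor_atTop.comp (tendsto_id.const_mul_atTop ha)
  have hratio : Tendsto (fun T : ℝ => (⌊a * T⌋₊ : ℝ) / T) atTop (nhds a) :=
    tendsto_nat_floor_mul_div_atTop ha.le
  have hlogratio := hratio.log ha.ne'
  have hfact := tendsto_log_factorial_sub_div.comp hfloor
  have hweight : Tendsto (fun T : ℝ => Real.log w / T) atTop (nhds 0) :=
    tendsto_const_nhds.div_atTop tendsto_id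
  have hlim := ((hratio.mul ((hfact.add hlogratio).sub_const (1 + Real.log r))).add_const r).sub
    hweight
  have hrate : a * (0 + Real.log a - (1 + Real.log r)) + r - 0
      = a * Real.log (a / r) - a + r := by
    rw [Real.log_div ha.ne' hr.ne']
    ring
  rw [hrate] at hlim
  refine hlim.congr' ?_
  filter_upwards [eventually_gt_atTop 0, hfloor.eventually_ge_atTop 1] with T hT hn
  simp only [Function.comp_apply]
  generalize ⌊a * T⌋₊ = n at hn ⊢
  have hn0 : (n : ℝ) ≠ 0 := by positivity
  rw [Real.log_div hn0 hT.ne', Real.log_div (by positivity) (by positivity),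
    Real.log_mul (by positivity) (by positivity),
    Real.log_mul (by positivity) (by positivity), Real.log_pow, Real.log_exp,
    Real.log_mul hr.ne' hT.ne']
  field_simp
  ring

/-- The decay rate of a sum of positive functions is the smaller of the two decay rates. -/
lemma tendsto_neg_log_add_min {x y : ℝ → ℝ} {A B : ℝ}
    (hx0 : ∀ᶠ T in atTop, 0 < x T) (hy0 : ∀ᶠ T in atTop, 0 < y T)
    (hx : Tendsto (fun T : ℝ => -(1 / T) * Real.log (x T)) atTop (nhds A))
    (hy : Tendsto (fun T : ℝ => -(1 / T) * Real.log (y T)) atTop (nhds B)) :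
    Tendsto (fun T : ℝ => -(1 / T) * Real.log (x T + y T)) atTop (nhds (min A B)) := by
  have hlog : Tendsto (fun T : ℝ => Real.log 2 / T) atTop (nhds 0) :=
    tendsto_const_nhds.div_atTop tendsto_id
  have hlower := (hx.min hy).sub hlog
  rw [sub_zero] at hlower
  refine tendsto_of_tendsto_of_tendsto_of_le_of_le' hlower (hx.min hy) ?_ ?_
  · filter_upwards [eventually_gt_atTop 0, hx0, hy0] with T hT hxT hyT
    have hinv : 0 < 1 / T := by positivity
    rcases le_total (x T) (y T) with h | h
    · have hle : Real.log (x T + y T) ≤ Real.log 2 + Real.log (y T) := by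
        rw [← Real.log_mul two_ne_zero hyT.ne']
        exact Real.log_le_log (by positivity) (by linarith)
      have hscaled := mul_le_mul_of_nonneg_left hle hinv.le
      have := min_le_right (-(1 / T) * Real.log (x T)) (-(1 / T) * Real.log (y T))
      have hdiv : Real.log 2 / T = 1 / T * Real.log 2 := by ring
      linarith
    · have hle : Real.log (x T + y T) ≤ Real.log 2 + Real.log (x T) := by
        rw [← Real.log_mul two_ne_zero hxT.ne']
        exact Real.log_le_log (by positivity) (by linarith)
      have hscaled := mul_le_mul_of_nonneg_left hle hinv.le
      have := min_le_left (-(1 / T) * Real.log (x T)) (-(1 / T) * Real.log (y T))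
      have hdiv : Real.log 2 / T = 1 / T * Real.log 2 := by ring
      linarith
  · filter_upwards [eventually_gt_atTop 0, hx0, hy0] with T hT hxT hyT
    have hinv : -(1 / T) ≤ 0 := by
      rw [neg_nonpos]
      positivity
    exact le_min
      (mul_le_mul_of_nonpos_left (Real.log_le_log hxT (by linarith)) hinv)
      (mul_le_mul_of_nonpos_left (Real.log_le_log hyT (by linarith)) hinv)

/-- The smaller of the two Poisson rate functions, with the crossover at `a = 1 / log 2`. -/
lemma min_poisson_rate_eq_ite {a : ℝ} (ha : 0 < a) :
    min (a * Real.log a - a + 1) (a * Real.log (a / 2) - a + 2) =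
      if a < 1 / Real.log 2 then a * Real.log a - a + 1 else a * Real.log (a / 2) - a + 2 := by
  have hlog2 : 0 < Real.log 2 := Real.log_pos one_lt_two
  rw [Real.log_div ha.ne' two_ne_zero]
  split_ifs with h
  · rw [lt_div_iff₀ hlog2] at h
    exact min_eq_left (by linarith)
  · rw [lt_div_iff₀ hlog2, not_lt] at h
    exact min_eq_right (by linarith)

/-- The microcanonical large deviation function of the activity of the four-state model:
the mixture `P_T = w₁ T^{⌊aT⌋}e^{−T}/⌊aT⌋! + w₂ (2T)^{⌊aT⌋}e^{−2T}/⌊aT⌋!` of two Poisson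
probabilities decays at rate `a ln a − a + 1` for `0 < a < 1/ln 2` and at rate
`a ln(a/2) − a + 2` for `a ≥ 1/ln 2`; this rate function is non-convex. -/
theorem microcanonical_activity_ldf_four_state
    (w₁ w₂ : ℝ) (hw₁ : 0 < w₁) (hw₂ : 0 < w₂) (hsum : w₁ + w₂ = 1)
    (Imc : ℝ → ℝ)
    (hImc : ∀ a : ℝ, Imc a =
      if a < 1 / Real.log 2 then a * Real.log a - a + 1 else a * Real.log (a / 2) - a + 2) :
    (∀ a : ℝ, 0 < a →
      Tendsto (fun T : ℝ => -(1 / T) * Real.log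
          (w₁ * T ^ ⌊a * T⌋₊ * exp (-T) / (Nat.factorial ⌊a * T⌋₊)
            + w₂ * (2 * T) ^ ⌊a * T⌋₊ * exp (-(2 * T)) / (Nat.factorial ⌊a * T⌋₊)))
        atTop (nhds (Imc a))) ∧
    ¬ ConvexOn ℝ (Set.Ioi (0 : ℝ)) Imc := by
  refine ⟨fun a ha => ?_, fun hconv => ?_⟩
  · rw [hImc, ← min_poisson_rate_eq_ite ha]
    have hslow := tendsto_neg_log_poisson_weight hw₁ one_pos ha
    simp only [one_mul, div_one] at hslow
    refine tendsto_neg_log_add_min ?_ ?_ hslow (tendsto_neg_log_poisson_weight hw₂ two_pos ha)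
    all_goals
      filter_upwards [eventually_gt_atTop 0] with T hT
      positivity
  · have hlog2 : 0 < Real.log 2 := Real.log_pos one_lt_two
    have hlower := Real.log_two_gt_d9
    have hupper := Real.log_two_lt_d9
    have hone : Imc 1 = 0 := by
      rw [hImc, if_pos (by rw [lt_div_iff₀ hlog2]; linarith), Real.log_one]
      norm_num
    have htwo : Imc 2 = 0 := by
      rw [hImc, if_neg (by rw [lt_div_iff₀ hlog2]; linarith), div_self two_ne_zero, Real.log_one]
      norm_num
    have hmid : 0 < Imc (3 / 2) := by
      rw [hImc, if_neg (by rw [lt_div_iff₀ hlog2]; linarith)]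
      have hlt : Real.log (4 / 3) < 4 / 3 - 1 :=
        Real.log_lt_sub_one_of_pos (by norm_num) (by norm_num)
      have hinv : Real.log (3 / 2 / 2) = -Real.log (4 / 3) := by
        rw [← Real.log_inv]
        norm_num
      rw [hinv]
      linarith
    have hchord := hconv.2 (Set.mem_Ioi.2 one_pos) (Set.mem_Ioi.2 two_pos)
      (by norm_num : (0 : ℝ) ≤ 1 / 2) (by norm_num : (0 : ℝ) ≤ 1 / 2) (by norm_num)
    rw [hone, htwo] at hchord
    norm_num at hchord
    linarith
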